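/- If G is a finite nilpotent group with α(G) = 3/4, then G is a 2-group, and either the commutator subgroup G' equals the Frattini subgroup Φ(G), or G/G' ≅ (Z/2)^n × Z/4 for some n ∈ ℕ and G' is an elementary abelian 2-group. -/

import Mathlib

/-- `α(G) = |L₁(G)| / |G|`, where `L₁(G)` is the set of cyclic subgroups of `G`. -/
noncomputable def alpha (G : Type*) [Group G] : ℚ :=
  (Nat.card {H : Subgroup G // IsCyclic H} : ℚ) / (Nat.card G : ℚ)

open Finset

/-- The generators of a given cyclic subgroup of order `n` number `φ(n)`. -/
lemma card_zpowers_eq_zpowers {G : Type*} [Group G] [Finite G] (g : G) :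
    Nat.card {x : G // Subgroup.zpowers x = Subgroup.zpowers g} = (orderOf g).totient := by
  classical
  have := Fintype.ofFinite G
  rw [← IsCyclic.card_orderOf_eq_totient (α := Subgroup.zpowers g) (d := orderOf g)
    (by simp [Fintype.card_zpowers]), ← Fintype.card_subtype, ← Nat.card_eq_fintype_card]
  refine Nat.card_congr ⟨fun x => ⟨⟨x.1, ?_⟩, ?_⟩, fun x => ⟨x.1.1, ?_⟩, fun _ => rfl, fun _ => rfl⟩
  · exact x.2.le (Subgroup.mem_zpowers _)
  · rw [Subgroup.orderOf_mk, ← Nat.card_zpowers, x.2, Nat.card_zpowers]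
  · refine Subgroup.eq_of_le_of_card_ge (by simp) ?_
    rw [Nat.card_zpowers, Nat.card_zpowers, Subgroup.orderOf_coe]
    exact x.2.ge

lemma card_isCyclic_subgroup (G : Type*) [Group G] [Fintype G] :
    (Nat.card {H : Subgroup G // IsCyclic H} : ℚ) = ∑ g : G, ((orderOf g).totient : ℚ)⁻¹ := by
  classical
  have : Fintype {H : Subgroup G // IsCyclic H} := Fintype.ofFinite _
  let f : G → {H : Subgroup G // IsCyclic H} := fun g => ⟨Subgroup.zpowers g, inferInstance⟩
  rw [← Finset.sum_fiberwise (s := univ) (g := f), Nat.card_eq_fintype_card,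
    ← Finset.card_univ, Finset.card_eq_sum_ones, Nat.cast_sum]
  refine Finset.sum_congr rfl fun H _ => ?_
  obtain ⟨g, hg⟩ := (Subgroup.isCyclic_iff_exists_zpowers_eq_top H.1).1 H.2
  have hf (x : G) : f x = H ↔ Subgroup.zpowers x = Subgroup.zpowers g := by
    rw [hg, Subtype.ext_iff]
  have hconst : ∀ x ∈ univ.filter (f · = H),
      ((orderOf x).totient : ℚ)⁻¹ = ((orderOf g).totient : ℚ)⁻¹ := by
    intro x hx
    rw [← Nat.card_zpowers, (hf x).1 (by simpa using hx), Nat.card_zpowers]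
  have hcard : #(univ.filter (f · = H)) = (orderOf g).totient := by
    rw [← card_zpowers_eq_zpowers, ← Fintype.card_subtype, ← Nat.card_eq_fintype_card]
    simp only [hf]
  rw [Finset.sum_congr rfl hconst, Finset.sum_const, nsmul_eq_mul, hcard, mul_inv_cancel₀]
  · simp
  · exact_mod_cast (Nat.totient_pos.2 (orderOf_pos g)).ne'

lemma alpha_eq_sum (G : Type*) [Group G] [Fintype G] :
    alpha G = (∑ g : G, ((orderOf g).totient : ℚ)⁻¹) / Nat.card G := by
  rw [alpha, card_isCyclic_subgroup]

/-- Averages over a quotient are averages over the group. -/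
lemma sum_comp_div_card {G H : Type*} [Group G] [Group H] [Fintype G] [Fintype H]
    {f : G →* H} (hf : Function.Surjective f) (F : H → ℚ) :
    (∑ g, F (f g)) / Nat.card G = (∑ h, F h) / Nat.card H := by
  classical
  let c := #{g | f g = 1}
  have hc (h : H) : #{g | f g = h} = c :=
    MonoidHom.card_fiber_eq_of_mem_range f (hf h) (hf 1)
  have key (F : H → ℚ) : ∑ g, F (f g) = c * ∑ h, F h := by
    rw [← Finset.sum_fiberwise (s := univ) (g := f), Finset.mul_sum]
    refine Finset.sum_congr rfl fun h _ => ?_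
    rw [← hc h, ← nsmul_eq_mul, ← Finset.sum_const]
    exact Finset.sum_congr rfl fun g hg => by rw [(Finset.mem_filter.1 hg).2]
  have hG := key fun _ => 1
  simp only [sum_const, card_univ, nsmul_eq_mul, mul_one] at hG
  rw [key, Nat.card_eq_fintype_card, Nat.card_eq_fintype_card, hG]
  refine mul_div_mul_left _ _ ?_
  rintro h0
  simp [h0] at hG

lemma alpha_le_of_surjective {G H : Type*} [Group G] [Group H] [Finite G]
    {f : G →* H} (hf : Function.Surjective f) : alpha G ≤ alpha H := by
  have := Fintype.ofFinite G
  have := Finite.of_surjective f hf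
  have := Fintype.ofFinite H
  rw [alpha_eq_sum, alpha_eq_sum, ← sum_comp_div_card hf fun h => ((orderOf h).totient : ℚ)⁻¹]
  gcongr with g
  · exact_mod_cast Nat.totient_pos.2 (orderOf_pos _)
  · exact Nat.le_of_dvd (Nat.totient_pos.2 (orderOf_pos _))
      (Nat.totient_dvd_of_dvd (orderOf_map_dvd f g))

lemma sq_eq_one_of_totient_orderOf_eq_one {G : Type*} [Group G] {g : G}
    (h : (orderOf g).totient = 1) : g ^ 2 = 1 := by
  rw [Nat.totient_eq_one_iff] at h
  exact orderOf_dvd_iff_pow_eq_one.1 (by rcases h with h | h <;> simp [h])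

lemma sq_eq_one_of_mem_ker_of_alpha_eq {G H : Type*} [Group G] [Group H] [Finite G]
    {f : G →* H} (hf : Function.Surjective f) (h : alpha G = alpha H) {x : G} (hx : x ∈ f.ker) :
    x ^ 2 = 1 := by
  have := Fintype.ofFinite G
  have := Finite.of_surjective f hf
  have := Fintype.ofFinite H
  rw [alpha_eq_sum, alpha_eq_sum, ← sum_comp_div_card hf fun h => ((orderOf h).totient : ℚ)⁻¹,
    div_left_inj' (by exact_mod_cast Nat.card_pos.ne'),
    Finset.sum_eq_sum_iff_of_le] at h
  · have hx' := h x (mem_univ _)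
    rw [f.mem_ker.1 hx, inv_inj] at hx'
    exact sq_eq_one_of_totient_orderOf_eq_one (by simpa using hx')
  · intro g _
    gcongr
    · exact_mod_cast Nat.totient_pos.2 (orderOf_pos _)
    · exact Nat.le_of_dvd (Nat.totient_pos.2 (orderOf_pos _))
        (Nat.totient_dvd_of_dvd (orderOf_map_dvd f g))

lemma alpha_le_of_card_sq_eq_one (G : Type*) [Group G] [Finite G] :
    alpha G ≤ (1 + (Nat.card {g : G // g ^ 2 = 1} : ℚ) / Nat.card G) / 2 := by
  classical
  have := Fintype.ofFinite G
  have hG : (0 : ℚ) < Fintype.card G := by exact_mod_cast Fintype.card_pos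
  have hle (g : G) : ((orderOf g).totient : ℚ)⁻¹ ≤ (1 + if g ^ 2 = 1 then 1 else 0) / 2 := by
    have hpos : 0 < (orderOf g).totient := Nat.totient_pos.2 (orderOf_pos g)
    split_ifs with hg
    · norm_num
      exact inv_le_one_of_one_le₀ (by exact_mod_cast hpos)
    · have h2 : 2 ≤ (orderOf g).totient := by
        by_contra! hlt
        exact hg (sq_eq_one_of_totient_orderOf_eq_one (by omega))
      rw [add_zero, one_div]
      gcongr
      exact_mod_cast h2
  have hsum := Finset.sum_le_sum fun g (_ : g ∈ univ) => hle g
  rw [← Finset.sum_div, Finset.sum_add_distrib, Finset.sum_boole, Finset.sum_const, card_univ,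
    nsmul_eq_mul, mul_one] at hsum
  rw [alpha_eq_sum, Nat.card_eq_fintype_card, Nat.card_eq_fintype_card, Fintype.card_subtype,
    div_le_iff₀ hG]
  refine hsum.trans (le_of_eq ?_)
  field_simp

lemma IsPGroup.alpha_le_two_thirds {p : ℕ} [Fact p.Prime] {P : Type*} [Group P] [Finite P]
    [Nontrivial P] (hP : IsPGroup p P) (hp : p ≠ 2) : alpha P ≤ 2 / 3 := by
  refine (alpha_le_of_card_sq_eq_one P).trans ?_
  have hsub : Subsingleton {g : P // g ^ 2 = 1} := by
    have h1 (g : P) (hg : g ^ 2 = 1) : g = 1 := by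
      obtain ⟨k, hk⟩ := IsPGroup.iff_orderOf.1 hP g
      have hcop : Nat.Coprime (p ^ k) 2 :=
        Nat.Coprime.pow_left k ((Nat.coprime_primes Fact.out Nat.prime_two).2 hp)
      rw [← orderOf_eq_one_iff]
      exact Nat.eq_one_of_dvd_coprimes hcop hk.dvd (orderOf_dvd_of_pow_eq_one hg)
    exact ⟨fun a b => Subtype.ext ((h1 _ a.2).trans (h1 _ b.2).symm)⟩
  have hcard : 3 ≤ Nat.card P := by
    obtain ⟨n, hn, hPn⟩ := hP.nontrivial_iff_card.1 inferInstance
    have hp3 : 3 ≤ p := by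
      have := (Fact.out : p.Prime).two_le
      omega
    exact hPn ▸ hp3.trans (Nat.le_self_pow hn.ne' p)
  have hone : Nat.card {g : P // g ^ 2 = 1} ≤ 1 := Finite.card_le_one_iff_subsingleton.2 hsub
  have hdiv : (Nat.card {g : P // g ^ 2 = 1} : ℚ) / Nat.card P ≤ 1 / 3 := by
    gcongr
    · exact_mod_cast hone
    · exact_mod_cast hcard
  linarith

lemma isPGroup_two_of_two_thirds_lt_alpha {G : Type*} [Group G] [Finite G]
    (hnil : Group.IsNilpotent G) (hα : 2 / 3 < alpha G) : IsPGroup 2 G := by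
  refine IsPGroup.of_card (n := (Nat.card G).primeFactorsList.length)
    (Nat.eq_prime_pow_of_unique_prime_dvd Nat.card_pos.ne' fun {p} hp hdvd => ?_)
  by_contra hp2
  have := Fact.mk hp
  obtain ⟨e⟩ := (Group.isNilpotent_of_finite_tfae (G := G).out 0 4).1 hnil
  let q : (Nat.card G).primeFactors := ⟨p, Nat.mem_primeFactors.2 ⟨hp, hdvd, Nat.card_pos.ne'⟩⟩
  let P : Sylow (q : ℕ) G := default
  let f : G →* P :=
    ((Pi.evalMonoidHom (fun P : Sylow (q : ℕ) G => (P : Subgroup G)) P).comp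
      (Pi.evalMonoidHom
        (fun p : (Nat.card G).primeFactors => ∀ P : Sylow (p : ℕ) G, (P : Subgroup G)) q)).comp
      e.symm.toMonoidHom
  have hf : Function.Surjective f :=
    ((Function.surjective_eval
      (β := fun P : Sylow (q : ℕ) G => (P : Subgroup G)) P).comp (Function.surjective_eval
      (β := fun p : (Nat.card G).primeFactors => ∀ P : Sylow (p : ℕ) G, (P : Subgroup G)) q)).comp e.symm.surjective
  have : Fact (q : ℕ).Prime := ⟨hp⟩
  have : Nontrivial P := (Subgroup.nontrivial_iff_ne_bot _).2 (P.ne_bot_of_dvd_card hdvd)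
  have hle := (alpha_le_of_surjective hf).trans (P.isPGroup'.alpha_le_two_thirds hp2)
  linarith

lemma commutator_le_frattini {G : Type*} [Group G] (hnil : Group.IsNilpotent G) :
    commutator G ≤ frattini G := by
  refine le_iInf₂ fun M (hM : IsCoatom M) => ?_
  have hnormal : M.Normal :=
    Subgroup.NormalizerCondition.normal_of_coatom M Group.normalizerCondition_of_isNilpotent hM
  have : Nontrivial (G ⧸ M) := QuotientGroup.nontrivial_iff.2 hM.1
  have hlt := Group.IsSolvable.commutator_lt_top_of_nontrivial (G ⧸ M)
  have hle : M ≤ (commutator (G ⧸ M)).comap (QuotientGroup.mk' M) := by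
    simpa using (QuotientGroup.mk' M).ker_le_comap (commutator (G ⧸ M))
  rcases hM.le_iff.1 hle with h | h
  · rw [← Subgroup.comap_top (QuotientGroup.mk' M)] at h
    exact absurd (Subgroup.comap_injective (QuotientGroup.mk'_surjective M) h) hlt.ne
  · rw [← h, ← Subgroup.map_le_iff_le_comap]
    rw [commutator_def, commutator_def, Subgroup.map_commutator]
    exact Subgroup.commutator_mono le_top le_top

lemma frattini_le_ker_of_sq_eq_one {G A : Type*} [Group G] [CommGroup A] {f : G →* A}
    (hf : Function.Surjective f) (hA : ∀ a : A, a ^ 2 = 1) : frattini G ≤ f.ker := by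
  intro x hx
  let _ : Module (ZMod 2) (Additive A) := AddCommGroup.zmodModule hA
  have key : Additive.ofMul (f x) = 0 := by
    rw [← Module.forall_dual_apply_eq_zero_iff (ZMod 2)]
    intro φ
    by_contra hφ
    have hφs : Function.Surjective φ := LinearMap.surjective (by rintro rfl; exact hφ rfl)
    let ψ : G →* Multiplicative (ZMod 2) :=
      (AddMonoidHom.toMultiplicativeRight φ.toAddMonoidHom).comp f
    have hψ : Function.Surjective ψ := hφs.comp hf
    have : IsSimpleGroup (Multiplicative (ZMod 2)) :=
      CommGroup.is_simple_iff_prime_card.2 (by simpa using Nat.prime_two)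
    exact hφ (frattini_le_coatom (Subgroup.isCoatom_comap_of_surjective hψ isCoatom_bot) hx)
  exact key

lemma exists_addEquiv_pi_zmod_two_prod_zmod_four {A : Type*} [AddCommGroup A] [Finite A] {x : A}
    (hx : 2 • x ≠ 0) (h : ∀ a : A, 2 • a = 0 ∨ 2 • (a - x) = 0) :
    ∃ n : ℕ, Nonempty (A ≃+ (Fin n → ZMod 2) × ZMod 4) := by
  have h4 : 2 • (2 • x) = 0 := (h (2 • x)).resolve_right (by simpa [two_nsmul] using hx)
  let T : AddSubgroup A := (nsmulAddMonoidHom 2 : A →+ A).ker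
  let _ : Module (ZMod 2) T := AddCommGroup.zmodModule fun t => Subtype.ext t.2
  let z : T := ⟨2 • x, h4⟩
  obtain ⟨W, hW⟩ := Submodule.exists_isCompl (Submodule.span (ZMod 2) {z})
  let e := (Module.finBasis (ZMod 2) W).equivFun
  let i : (Fin (Module.finrank (ZMod 2) W) → ZMod 2) →+ A :=
    (T.subtype.comp W.subtype.toAddMonoidHom).comp e.symm.toLinearMap.toAddMonoidHom
  let j : ZMod 4 →+ A := ZMod.lift 4 ⟨zmultiplesHom A x, by
    have : (4 : ℤ) • x = 2 • (2 • x) := by module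
    simpa [this] using h4⟩
  have hi (v) : i v = ((e.symm v : W) : T) := rfl
  have hj (k : ℤ) : j k = k • x := by simp [j]
  refine ⟨_, ⟨(AddEquiv.ofBijective (i.coprod j) ⟨?_, ?_⟩).symm⟩⟩
  · rw [injective_iff_map_eq_zero]
    rintro ⟨v, k⟩ hvk
    obtain ⟨k, rfl⟩ := ZMod.intCast_surjective k
    simp only [AddMonoidHom.coprod_apply, hi, hj] at hvk
    have h2w : 2 • (((e.symm v : W) : T) : A) = 0 := (e.symm v : T).2
    have hk : Even k := by
      by_contra hodd
      obtain ⟨m, rfl⟩ := Int.not_even_iff_odd.1 hodd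
      apply hx
      calc 2 • x = 2 • ((((e.symm v : W) : T) : A) + (2 * m + 1) • x)
            - 2 • (((e.symm v : W) : T) : A) - m • (2 • (2 • x)) := by module
        _ = 0 := by rw [hvk, h2w, h4]; simp
    obtain ⟨m, rfl⟩ := hk
    have hwz : ((e.symm v : W) : T) = -(m • z) := by
      refine Subtype.ext ?_
      rw [AddSubgroup.coe_neg, AddSubgroup.coe_zsmul, ← add_eq_zero_iff_eq_neg, ← hvk]
      change _ + m • (2 • x) = _
      module
    have hw0 : ((e.symm v : W) : T) = 0 := by
      refine Submodule.disjoint_def.1 hW.disjoint _ ?_ (e.symm v).2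
      rw [hwz]
      exact neg_mem (zsmul_mem (Submodule.mem_span_singleton_self z) m)
    have hmz : m • (2 • x) = 0 := by
      rw [hw0, eq_comm, neg_eq_zero] at hwz
      exact congrArg Subtype.val hwz
    have hm : Even m := by
      by_contra hodd
      obtain ⟨l, rfl⟩ := Int.not_even_iff_odd.1 hodd
      apply hx
      calc 2 • x = (2 * l + 1) • (2 • x) - l • (2 • (2 • x)) := by module
        _ = 0 := by rw [hmz, h4]; simp
    obtain ⟨l, rfl⟩ := hm
    refine Prod.ext ?_ ?_
    · exact e.symm.map_eq_zero_iff.1 (Subtype.ext hw0)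
    · exact (ZMod.intCast_zmod_eq_zero_iff_dvd _ 4).2 ⟨l, by push_cast; ring⟩
  · have hsurjT : ∀ t ∈ T, ∃ v, i.coprod j v = t := by
      intro t ht
      obtain ⟨u, hu, w, hw, huw⟩ := Submodule.mem_sup.1
        (hW.sup_eq_top ▸ Submodule.mem_top : (⟨t, ht⟩ : T) ∈ Submodule.span (ZMod 2) {z} ⊔ W)
      obtain ⟨c, rfl⟩ := Submodule.mem_span_singleton.1 hu
      obtain ⟨c, rfl⟩ := ZMod.intCast_surjective c
      refine ⟨(e ⟨w, hw⟩, ((2 * c : ℤ) : ZMod 4)), ?_⟩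
      rw [AddMonoidHom.coprod_apply, hi, hj, e.symm_apply_apply]
      rw [Int.cast_smul_eq_zsmul] at huw
      have ht' : c • (2 • x) + (w : A) = t := congrArg Subtype.val huw
      rw [← ht']
      module
    intro a
    rcases h a with ha | ha
    · exact hsurjT a ha
    · obtain ⟨v, hv⟩ := hsurjT _ ha
      refine ⟨v + (0, ((1 : ℤ) : ZMod 4)), ?_⟩
      rw [map_add, hv, AddMonoidHom.coprod_apply, map_zero, hj]
      simp

lemma index_ker_sq {A : Type*} [CommGroup A] [Finite A] (hα : 3 / 4 ≤ alpha A) {x : A}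
    (hx : x ^ 2 ≠ 1) : alpha A = 3 / 4 ∧ (powMonoidHom 2 : A →* A).ker.index = 2 := by
  set T := (powMonoidHom 2 : A →* A).ker with hT
  have hle := alpha_le_of_card_sq_eq_one A
  have hTcard : Nat.card {g : A // g ^ 2 = 1} = Nat.card T := rfl
  have hT0 : (0 : ℚ) < Nat.card T := by exact_mod_cast Nat.card_pos
  have hindex : T.index ≠ 1 := fun h1 => hx (by
    have : x ∈ T := by simp [Subgroup.index_eq_one.1 h1]
    exact this)
  have hindex0 : T.index ≠ 0 := Subgroup.index_ne_zero_of_finite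
  have hi2 : (2 : ℚ) ≤ T.index := by exact_mod_cast (by omega : 2 ≤ T.index)
  rw [hTcard, ← T.card_mul_index, Nat.cast_mul, div_mul_cancel_left₀ hT0.ne'] at hle
  have hinv : (T.index : ℚ)⁻¹ ≤ 2⁻¹ := by gcongr
  have hge : (2 : ℚ)⁻¹ ≤ (T.index : ℚ)⁻¹ := by linarith
  have hi2' : (T.index : ℚ) ≤ 2 := (inv_le_inv₀ (by norm_num) (by linarith)).1 hge
  exact ⟨by linarith, by exact_mod_cast le_antisymm hi2' hi2⟩

theorem stmt_6 (G : Type*) [Group G] [Finite G] (hnil : Group.IsNilpotent G)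
    (hα : alpha G = 3 / 4) :
    IsPGroup 2 G ∧
      (commutator G = frattini G ∨
        (∃ n : ℕ,
          Nonempty ((G ⧸ commutator G) ≃* Multiplicative ((Fin n → ZMod 2) × ZMod 4))) ∧
          ∀ x ∈ commutator G, x ^ 2 = 1) := by
  refine ⟨isPGroup_two_of_two_thirds_lt_alpha hnil (by rw [hα]; norm_num), ?_⟩
  have hsurj : Function.Surjective (Abelianization.of (G := G)) := QuotientGroup.mk_surjective
  have : Finite (Abelianization G) := Finite.of_surjective _ hsurj
  by_cases hA : ∀ a : Abelianization G, a ^ 2 = 1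
  · left
    refine le_antisymm (commutator_le_frattini hnil) ?_
    simpa using frattini_le_ker_of_sq_eq_one hsurj hA
  · right
    push Not at hA
    obtain ⟨x, hx⟩ := hA
    obtain ⟨hαA, hindex⟩ := index_ker_sq (hα ▸ alpha_le_of_surjective hsurj) hx
    refine ⟨?_, fun y hy => sq_eq_one_of_mem_ker_of_alpha_eq hsurj (hα.trans hαA.symm)
      (by simpa using hy)⟩
    obtain ⟨n, ⟨e⟩⟩ := exists_addEquiv_pi_zmod_two_prod_zmod_four
      (A := Additive (Abelianization G)) (x := Additive.ofMul x) hx fun a => by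
        by_contra! hcon
        have hmem : a.toMul / x ∈ (powMonoidHom 2 : Abelianization G →* _).ker := by
          rw [div_eq_mul_inv, Subgroup.mul_mem_iff_of_index_two hindex, inv_mem_iff]
          exact iff_of_false hcon.1 hx
        exact hcon.2 hmem
    exact ⟨n, ⟨AddEquiv.toMultiplicativeRight e⟩⟩
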